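/- Let 0 ≤ φ′ ≤ φ ≤ φ″ ≤ π and ψ ∈ [0, π]. If φ′ ≤ π/2 ≤ φ″, then v(φ, ψ) ≤ (cos((π/2 − φ′)/2))^{−1} · max(v(φ′, ψ), v(π/2, ψ)). -/

import Mathlib

open Real

/-- `v(φ, ψ) = cos φ − cos(φ + ψ)` if `φ + ψ ≤ π`, and `cos φ + 1` otherwise. -/
noncomputable def v (φ ψ : ℝ) : ℝ :=
  if φ + ψ ≤ π then Real.cos φ - Real.cos (φ + ψ) else Real.cos φ + 1

theorem v_eq_of_add_le {φ ψ : ℝ} (h : φ + ψ ≤ π) :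
    v φ ψ = 2 * sin (ψ / 2) * cos (φ + ψ / 2 - π / 2) := by
  rw [v, if_pos h, cos_sub_cos, cos_sub_pi_div_two, show (φ + (φ + ψ)) / 2 = φ + ψ / 2 by ring,
    show (φ - (φ + ψ)) / 2 = -(ψ / 2) by ring, sin_neg]
  ring

theorem v_nonneg {φ ψ : ℝ} (hφ : 0 ≤ φ) (hψ : 0 ≤ ψ) : 0 ≤ v φ ψ := by
  unfold v
  split_ifs with h
  · linarith [cos_le_cos_of_nonneg_of_le_pi hφ h (by linarith)]
  · linarith [neg_one_le_cos φ]

theorem sin_le_v_pi_div_two (ψ : ℝ) : sin ψ ≤ v (π / 2) ψ := by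
  unfold v
  split_ifs
  · rw [add_comm, cos_add_pi_div_two, cos_pi_div_two]
    linarith
  · rw [cos_pi_div_two]
    linarith [sin_le_one ψ]

theorem one_add_cos_le_of_pi_le_add {φ ψ : ℝ} (hφ : φ ≤ π) (hψ : ψ ≤ π) (h : π ≤ φ + ψ) :
    cos φ + 1 ≤ 2 * sin (ψ / 2) * sin (ψ / 2) := by
  have hcos : cos φ ≤ cos (π - ψ) :=
    cos_le_cos_of_nonneg_of_le_pi (by linarith) hφ (by linarith)
  have hdouble : cos ψ = 1 - 2 * sin (ψ / 2) * sin (ψ / 2) := by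
    have := cos_two_mul (ψ / 2)
    rw [mul_div_cancel₀ ψ (two_ne_zero' ℝ)] at this
    nlinarith [sin_sq_add_cos_sq (ψ / 2)]
  rw [cos_pi_sub] at hcos
  linarith

theorem v_le_two_mul_sin {φ ψ : ℝ} (hφ : φ ≤ π) (h0 : 0 ≤ ψ) (hψ : ψ ≤ π) :
    v φ ψ ≤ 2 * sin (ψ / 2) := by
  have hsin : 0 ≤ sin (ψ / 2) := sin_nonneg_of_nonneg_of_le_pi (by linarith) (by linarith)
  rcases le_or_gt (φ + ψ) π with h | h
  · rw [v_eq_of_add_le h]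
    exact mul_le_of_le_one_right (by linarith) (cos_le_one _)
  · rw [v, if_neg h.not_ge]
    exact (one_add_cos_le_of_pi_le_add hφ hψ h.le).trans
      (mul_le_of_le_one_right (by linarith) (sin_le_one _))

theorem v_antitoneOn {ψ : ℝ} (h0 : 0 ≤ ψ) (hψ : ψ ≤ π) :
    AntitoneOn (v · ψ) (Set.Icc (π / 2 - ψ / 2) π) := by
  rintro x ⟨hx, -⟩ y ⟨-, hy⟩ hxy
  have hsin : 0 ≤ sin (ψ / 2) := sin_nonneg_of_nonneg_of_le_pi (by linarith) (by linarith)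
  have hpi := pi_pos
  change v y ψ ≤ v x ψ
  rcases le_or_gt (y + ψ) π with h | h
  · rw [v_eq_of_add_le h, v_eq_of_add_le (by linarith : x + ψ ≤ π)]
    exact mul_le_mul_of_nonneg_left
      (cos_le_cos_of_nonneg_of_le_pi (by linarith) (by linarith) (by linarith)) (by linarith)
  · rw [v, if_neg h.not_ge]
    rcases le_or_gt (x + ψ) π with h' | h'
    · rw [v_eq_of_add_le h']
      refine (one_add_cos_le_of_pi_le_add hy hψ h.le).trans
        (mul_le_mul_of_nonneg_left ?_ (by linarith))
      rw [← cos_pi_div_two_sub]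
      exact cos_le_cos_of_nonneg_of_le_pi (by linarith) (by linarith) (by linarith)
    · rw [v, if_neg h'.not_ge]
      linarith [cos_le_cos_of_nonneg_of_le_pi (by linarith : 0 ≤ x) hy hxy]

theorem v_le_of_mem_pi_div_two (φ' φ φ'' ψ : ℝ)
    (h0 : 0 ≤ φ') (h1 : φ' ≤ φ) (h2 : φ ≤ φ'') (h3 : φ'' ≤ π)
    (hψ : ψ ∈ Set.Icc 0 π) (h' : φ' ≤ π / 2) (h'' : π / 2 ≤ φ'') :
    v φ ψ ≤ (Real.cos ((π / 2 - φ') / 2))⁻¹ * max (v φ' ψ) (v (π / 2) ψ) := by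
  obtain ⟨hψ0, hψπ⟩ := hψ
  have hpi := pi_pos
  have hφ : φ ≤ π := h2.trans h3
  have hc : 0 < cos ((π / 2 - φ') / 2) := cos_pos_of_mem_Ioo ⟨by linarith, by linarith⟩
  have hsin : 0 ≤ 2 * sin (ψ / 2) :=
    mul_nonneg zero_le_two (sin_nonneg_of_nonneg_of_le_pi (by linarith) (by linarith))
  rw [le_inv_mul_iff₀ hc]
  rcases le_or_gt (π / 2 - ψ / 2) φ' with h | h
  · exact (mul_le_of_le_one_left (v_nonneg (h0.trans h1) hψ0) (cos_le_one _)).trans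
      ((v_antitoneOn hψ0 hψπ ⟨h, h1.trans hφ⟩ ⟨h.trans h1, hφ⟩ h1).trans (le_max_left _ _))
  refine (mul_le_mul_of_nonneg_left (v_le_two_mul_sin hφ hψ0 hψπ) hc.le).trans ?_
  rw [mul_comm]
  rcases le_or_gt (π / 2 - φ') ψ with hle | hlt
  · refine le_max_of_le_left ?_
    rw [v_eq_of_add_le (by linarith : φ' + ψ ≤ π), ← cos_neg (φ' + ψ / 2 - π / 2)]
    exact mul_le_mul_of_nonneg_left
      (cos_le_cos_of_nonneg_of_le_pi (by linarith) (by linarith) (by linarith)) hsin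
  · refine le_max_of_le_right (le_trans ?_ (sin_le_v_pi_div_two ψ))
    have hdouble := sin_two_mul (ψ / 2)
    rw [mul_div_cancel₀ ψ (two_ne_zero' ℝ)] at hdouble
    rw [hdouble]
    exact mul_le_mul_of_nonneg_left
      (cos_le_cos_of_nonneg_of_le_pi (by linarith) (by linarith) (by linarith)) hsin
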